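/- Let φ(x) = (2π)^(−1/2) exp(−x²/2) denote the standard normal density and Φ(x) = ∫_{−∞}^x φ(t) dt the standard normal CDF. Fix σ > 0 and thresholds a < b. Then the per-entry Probit negative log-likelihood h : ℝ → ℝ given by h(x) = −log( Φ((b − x)/σ) − Φ((a − x)/σ) ) is a convex function on ℝ. -/

import Mathlib

open MeasureTheory

/-- The standard normal density `φ(x) = (2π)^(−1/2) exp(−x²/2)`. -/
noncomputable def stdNormalPDF (x : ℝ) : ℝ :=
  (Real.sqrt (2 * Real.pi))⁻¹ * Real.exp (-x ^ 2 / 2)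

/-- The standard normal CDF `Φ(x) = ∫_{−∞}^x φ(t) dt`. -/
noncomputable def stdNormalCDF (x : ℝ) : ℝ :=
  ∫ t in Set.Iic x, stdNormalPDF t

lemma stdNormalPDF_pos (x : ℝ) : 0 < stdNormalPDF x := by
  unfold stdNormalPDF
  positivity

lemma hasDerivAt_stdNormalPDF (x : ℝ) :
    HasDerivAt stdNormalPDF (-(x * stdNormalPDF x)) x := by
  have h : HasDerivAt (fun y : ℝ => -y ^ 2 / 2) (-x) x := by
    refine ((hasDerivAt_pow 2 x).neg.div_const 2).congr_deriv ?_
    norm_num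
    ring
  refine (h.exp.const_mul (Real.sqrt (2 * Real.pi))⁻¹).congr_deriv ?_
  unfold stdNormalPDF
  ring

lemma continuous_stdNormalPDF : Continuous stdNormalPDF :=
  continuous_iff_continuousAt.2 fun x => (hasDerivAt_stdNormalPDF x).continuousAt

lemma integrable_stdNormalPDF : Integrable stdNormalPDF := by
  convert (integrable_exp_neg_mul_sq (b := 1 / 2) (by norm_num)).const_mul
    (Real.sqrt (2 * Real.pi))⁻¹ using 1
  funext x
  unfold stdNormalPDF
  ring_nf

lemma hasDerivAt_stdNormalCDF (x : ℝ) : HasDerivAt stdNormalCDF (stdNormalPDF x) x := by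
  have h : stdNormalCDF = fun y => stdNormalCDF 0 + ∫ t in (0 : ℝ)..y, stdNormalPDF t := by
    funext y
    rw [← intervalIntegral.integral_Iic_sub_Iic integrable_stdNormalPDF.integrableOn
      integrable_stdNormalPDF.integrableOn]
    simp [stdNormalCDF]
  rw [h]
  exact (continuous_stdNormalPDF.integral_hasStrictDerivAt 0 x).hasDerivAt.const_add _

lemma strictMono_stdNormalCDF : StrictMono stdNormalCDF :=
  strictMono_of_hasDerivAt_pos hasDerivAt_stdNormalCDF stdNormalPDF_pos

/-- The mean of a standard normal variable truncated to `[v, w]` is at least `v`. -/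
lemma mul_stdNormalCDF_sub_le {v w : ℝ} (h : v ≤ w) :
    v * (stdNormalCDF w - stdNormalCDF v) ≤ stdNormalPDF v - stdNormalPDF w := by
  have hd (t : ℝ) : HasDerivAt (fun t => -stdNormalPDF t - v * stdNormalCDF t)
      ((t - v) * stdNormalPDF t) t := by
    refine ((hasDerivAt_stdNormalPDF t).neg.sub
      ((hasDerivAt_stdNormalCDF t).const_mul v)).congr_deriv ?_
    ring
  have hm : MonotoneOn (fun t => -stdNormalPDF t - v * stdNormalCDF t) (Set.Ici v) := by
    refine monotoneOn_of_hasDerivWithinAt_nonneg (convex_Ici v)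
      (fun t _ => (hd t).continuousAt.continuousWithinAt)
      (fun t _ => (hd t).hasDerivWithinAt) fun t ht => ?_
    rw [interior_Ici] at ht
    exact mul_nonneg (sub_nonneg.2 (le_of_lt ht)) (stdNormalPDF_pos t).le
  have := hm Set.self_mem_Ici h h
  simp only at this
  linarith

/-- The mean of a standard normal variable truncated to `[v, w]` is at most `w`. -/
lemma stdNormalPDF_sub_le_mul {v w : ℝ} (h : v ≤ w) :
    stdNormalPDF v - stdNormalPDF w ≤ w * (stdNormalCDF w - stdNormalCDF v) := by
  have hd (t : ℝ) : HasDerivAt (fun t => -stdNormalPDF t - w * stdNormalCDF t)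
      ((t - w) * stdNormalPDF t) t := by
    refine ((hasDerivAt_stdNormalPDF t).neg.sub
      ((hasDerivAt_stdNormalCDF t).const_mul w)).congr_deriv ?_
    ring
  have hm : AntitoneOn (fun t => -stdNormalPDF t - w * stdNormalCDF t) (Set.Iic w) := by
    refine antitoneOn_of_hasDerivWithinAt_nonpos (convex_Iic w)
      (fun t _ => (hd t).continuousAt.continuousWithinAt)
      (fun t _ => (hd t).hasDerivWithinAt) fun t ht => ?_
    rw [interior_Iic] at ht
    exact mul_nonpos_of_nonpos_of_nonneg (sub_nonpos.2 (le_of_lt ht)) (stdNormalPDF_pos t).le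
  have := hm h Set.self_mem_Iic h
  simp only at this
  linarith

/-- The mean of a standard normal variable truncated to `[v, v + d]` is monotone in `v`. -/
lemma monotone_truncated_mean {d : ℝ} (hd : 0 < d) :
    Monotone fun v => (stdNormalPDF v - stdNormalPDF (v + d)) /
      (stdNormalCDF (v + d) - stdNormalCDF v) := by
  have hF (v : ℝ) : 0 < stdNormalCDF (v + d) - stdNormalCDF v :=
    sub_pos.2 (strictMono_stdNormalCDF (lt_add_of_pos_right v hd))
  refine monotone_of_hasDerivAt_nonneg (fun v =>
    ((hasDerivAt_stdNormalPDF v).sub ((hasDerivAt_stdNormalPDF (v + d)).comp_add_const v d)).div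
    (((hasDerivAt_stdNormalCDF (v + d)).comp_add_const v d).sub (hasDerivAt_stdNormalCDF v))
    (hF v).ne') fun v => div_nonneg ?_ (sq_nonneg _)
  have hv : v ≤ v + d := by linarith
  have h₁ := mul_nonneg (sub_nonneg.2 (mul_stdNormalCDF_sub_le hv)) (stdNormalPDF_pos v).le
  have h₂ := mul_nonneg (sub_nonneg.2 (stdNormalPDF_sub_le_mul hv)) (stdNormalPDF_pos (v + d)).le
  simp only [Pi.sub_apply]
  linarith

lemma convexOn_neg_log_stdNormalCDF_sub {d : ℝ} (hd : 0 < d) :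
    ConvexOn ℝ Set.univ fun v => -Real.log (stdNormalCDF (v + d) - stdNormalCDF v) := by
  have hF (v : ℝ) : 0 < stdNormalCDF (v + d) - stdNormalCDF v :=
    sub_pos.2 (strictMono_stdNormalCDF (lt_add_of_pos_right v hd))
  have hderiv (v : ℝ) :
      HasDerivAt (fun v => -Real.log (stdNormalCDF (v + d) - stdNormalCDF v))
        ((stdNormalPDF v - stdNormalPDF (v + d)) / (stdNormalCDF (v + d) - stdNormalCDF v)) v := by
    refine ((((hasDerivAt_stdNormalCDF (v + d)).comp_add_const v d).sub
      (hasDerivAt_stdNormalCDF v)).log (hF v).ne').neg.congr_deriv ?_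
    simp only [Pi.sub_apply]
    ring
  refine Monotone.convexOn_univ_of_deriv (fun v => (hderiv v).differentiableAt) ?_
  rw [funext fun v => (hderiv v).deriv]
  exact monotone_truncated_mean hd

/-- The per-entry Probit negative log-likelihood
`h(x) = −log(Φ((b − x)/σ) − Φ((a − x)/σ))` is convex on `ℝ`. -/
theorem probit_neg_log_likelihood_convex (σ a b : ℝ) (hσ : 0 < σ) (hab : a < b) :
    ConvexOn ℝ Set.univ
      (fun x : ℝ => -Real.log (stdNormalCDF ((b - x) / σ) - stdNormalCDF ((a - x) / σ))) := by
  have h := (convexOn_neg_log_stdNormalCDF_sub (div_pos (sub_pos.2 hab) hσ)).comp_affineMap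
    (AffineMap.lineMap (a / σ) ((a - 1) / σ))
  have hx (x : ℝ) : AffineMap.lineMap (a / σ) ((a - 1) / σ) x = (a - x) / σ := by
    rw [AffineMap.lineMap_apply_ring']
    ring
  have hb (x : ℝ) : (a - x) / σ + (b - a) / σ = (b - x) / σ := by ring
  simpa only [Function.comp_def, Set.preimage_univ, hx, hb] using h
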